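/- Let H be a complex Hilbert space, let B be a sesquilinear form on H coercive with constant c > 0 (Re B(v,v) ≥ c‖v‖² for all v), let P be a sesquilinear form on H with |P(w,v)| ≤ ε‖w‖‖v‖ for all w, v ∈ H, and let f be a continuous conjugate-linear functional on H. Suppose u ∈ H satisfies B(u,v) = f(v) for all v, suppose u_ε ∈ H satisfies B(u_ε,v) + P(u_ε,v) = f(v) for all v, and suppose u′ ∈ H satisfies B(u′,v) = −P(u,v) for all v. Then ‖u_ε − u − u′‖ ≤ (ε/c)‖u_ε − u‖. -/

import Mathlib

/-- Quadratic remainder estimate for the Fréchet derivative: if `B` is coercive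
with constant `c > 0`, `|P w v| ≤ ε ‖w‖ ‖v‖`, `u` solves `B u · = f`,
`uε` solves `(B + P) uε · = f`, and `u'` solves `B u' · = -P u ·`, then
`‖uε - u - u'‖ ≤ (ε/c) ‖uε - u‖`. -/
theorem stmt_3
    {H : Type*} [NormedAddCommGroup H] [InnerProductSpace ℂ H] [CompleteSpace H]
    (B P : H →ₗ[ℂ] H →ₗ⋆[ℂ] ℂ) (c ε : ℝ) (hc : 0 < c)
    (hcoer : ∀ v : H, c * ‖v‖ ^ 2 ≤ (B v v).re)
    (hP : ∀ w v : H, ‖P w v‖ ≤ ε * ‖w‖ * ‖v‖)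
    (f : H →L⋆[ℂ] ℂ) (u uε u' : H)
    (hu : ∀ v : H, B u v = f v)
    (huε : ∀ v : H, B uε v + P uε v = f v)
    (hu' : ∀ v : H, B u' v = -P u v) :
    ‖uε - u - u'‖ ≤ (ε / c) * ‖uε - u‖ := by
  have key : ∀ v : H, B (uε - u - u') v = -P (uε - u) v := fun v => by
    simp only [map_sub, LinearMap.sub_apply]
    linear_combination huε v - hu v - hu' v
  have hnonneg : 0 ≤ ε * ‖uε - u‖ := by
    rcases (norm_nonneg (uε - u)).eq_or_lt with h | h
    · simp [← h]
    · exact nonneg_of_mul_nonneg_left ((norm_nonneg _).trans (hP (uε - u) (uε - u))) h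
  have hbound : c * ‖uε - u - u'‖ ^ 2 ≤ ε * ‖uε - u‖ * ‖uε - u - u'‖ :=
    calc c * ‖uε - u - u'‖ ^ 2 ≤ (B (uε - u - u') (uε - u - u')).re := hcoer _
      _ ≤ ‖B (uε - u - u') (uε - u - u')‖ := Complex.re_le_norm _
      _ = ‖P (uε - u) (uε - u - u')‖ := by rw [key, norm_neg]
      _ ≤ ε * ‖uε - u‖ * ‖uε - u - u'‖ := hP _ _
  rw [div_mul_eq_mul_div, le_div_iff₀ hc, mul_comm]
  rcases (norm_nonneg (uε - u - u')).eq_or_lt with h | h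
  · rwa [← h, mul_zero]
  · exact le_of_mul_le_mul_right (by linarith [hbound, sq ‖uε - u - u'‖]) h
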